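/- arXiv:2406.13477 — 5 statements merged into one kernel-verified Lean document; each statement's English description precedes it below -/
import Mathlib

section
/- (Permutation Invariance) Let X be a vector space over a field K, let A : X → X be a bijective linear map and b ∈ X. For k ∈ {0,…,K} let M_k, N_k : X → X be linear with A = M_k − N_k and M_k bijective, and suppose the family is fully commuting: M_i ∘ N_j = N_j ∘ M_i, M_i ∘ M_j = M_j ∘ M_i, and N_i ∘ N_j = N_j ∘ N_i for all i, j ∈ {0,…,K}. Define the step maps S_j(x) := M_j⁻¹(N_j x + b). Then for every permutation σ of {0,…,K} and every initial value x⁰ ∈ X, (S_{σ(K)} ∘ ⋯ ∘ S_{σ(0)})(x⁰) = (S_K ∘ ⋯ ∘ S_0)(x⁰); i.e., the iterate after all K+1 steps does not depend on the order in which the steps are executed. -/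
/-- Folding a right-commutative function over `Fin n` does not depend on the order in which the
indices are visited. -/
theorem Fin.foldl_comp_perm {α : Type*} {n : ℕ} (f : α → Fin n → α) [RightCommutative f]
    (σ : Equiv.Perm (Fin n)) (a : α) :
    Fin.foldl n (fun x i => f x (σ i)) a = Fin.foldl n f a := by
  rw [Fin.foldl_eq_foldl_finRange, Fin.foldl_eq_foldl_finRange,
    ← List.foldl_map (f := σ) (g := f)]
  exact (Equiv.Perm.map_finRange_perm σ).foldl_eq a

/-- Two steps `x ↦ M⁻¹ (N x + b)` of splittings of the same linear map commute if the splittings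
commute with each other. -/
theorem splitting_step_comm {R X : Type*} [Ring R] [AddCommGroup X] [Module R X]
    {M₁ M₂ : X ≃ₗ[R] X} {N₁ N₂ : X →ₗ[R] X}
    (hsplit : M₁.toLinearMap - N₁ = M₂.toLinearMap - N₂)
    (hMN₁₂ : M₁.toLinearMap ∘ₗ N₂ = N₂ ∘ₗ M₁.toLinearMap)
    (hMN₂₁ : M₂.toLinearMap ∘ₗ N₁ = N₁ ∘ₗ M₂.toLinearMap)
    (hMM : M₁.toLinearMap ∘ₗ M₂.toLinearMap = M₂.toLinearMap ∘ₗ M₁.toLinearMap)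
    (hNN : N₁ ∘ₗ N₂ = N₂ ∘ₗ N₁) (b x : X) :
    M₂.symm (N₂ (M₁.symm (N₁ x + b)) + b) = M₁.symm (N₁ (M₂.symm (N₂ x + b)) + b) := by
  have hb : M₁ b - N₁ b = M₂ b - N₂ b := LinearMap.congr_fun hsplit b
  have h₁₂ (y : X) : M₁ (N₂ y) = N₂ (M₁ y) := LinearMap.congr_fun hMN₁₂ y
  have h₂₁ (y : X) : M₂ (N₁ y) = N₁ (M₂ y) := LinearMap.congr_fun hMN₂₁ y
  have hM (y : X) : M₁ (M₂ y) = M₂ (M₁ y) := LinearMap.congr_fun hMM y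
  have hN : N₁ (N₂ x) = N₂ (N₁ x) := LinearMap.congr_fun hNN x
  apply M₂.injective
  apply M₁.injective
  rw [hM (M₁.symm _)]
  simp only [LinearEquiv.apply_symm_apply, map_add, h₁₂, h₂₁, hN]
  rw [add_assoc, add_assoc, add_right_inj, add_comm (N₁ b)]
  exact (add_comm _ _).trans (sub_eq_sub_iff_add_eq_add.mp hb)

/-- Permutation invariance of a fully commuting nonstationary splitting scheme:
if `A = M_k - N_k` for all `k ∈ {0,…,K}`, with `A` bijective, every `M_k` bijective
(modeled as linear equivalences), and the family fully commuting, then after executing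
all `K+1` steps `x ↦ M_k⁻¹(N_k x + b)`, the result does not depend on the order of
the steps. -/
theorem permutation_invariance {K X : Type*} [Field K] [AddCommGroup X] [Module K X]
    (Kn : ℕ) (A : X →ₗ[K] X) (hAbij : Function.Bijective A) (b : X)
    (M : Fin (Kn + 1) → (X ≃ₗ[K] X)) (N : Fin (Kn + 1) → (X →ₗ[K] X))
    (hsplit : ∀ k, A = (M k).toLinearMap - N k)
    (hMN : ∀ i j, (M i).toLinearMap ∘ₗ N j = N j ∘ₗ (M i).toLinearMap)
    (hMM : ∀ i j, (M i).toLinearMap ∘ₗ (M j).toLinearMap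
                    = (M j).toLinearMap ∘ₗ (M i).toLinearMap)
    (hNN : ∀ i j, N i ∘ₗ N j = N j ∘ₗ N i)
    (σ : Equiv.Perm (Fin (Kn + 1))) (x0 : X) :
    Fin.foldl (Kn + 1) (fun x i => (M (σ i)).symm (N (σ i) x + b)) x0
      = Fin.foldl (Kn + 1) (fun x i => (M i).symm (N i x + b)) x0 := by
  have : RightCommutative fun (x : X) (i : Fin (Kn + 1)) => (M i).symm (N i x + b) :=
    ⟨fun x i j => splitting_step_comm ((hsplit i).symm.trans (hsplit j)) (hMN i j) (hMN j i)
      (hMM i j) (hNN i j) b x⟩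
  exact Fin.foldl_comp_perm (fun (x : X) i => (M i).symm (N i x + b)) σ x0
end

section
/- (Double-step M-operator) Let H and V be n×n complex matrices with H V = V H, and let α, β, α', β' ∈ ℂ with α + β ≠ 0 and α' + β' ≠ 0. Then (α'+β')(α+β) M(α',β') M(α,β) = (H² + (α+α') H + α α' I)(V² + (β+β') V + β β' I). Moreover, if H and V have real entries and α α', α+α', β β', β+β' ∈ ℝ, then this matrix has real entries. -/
open Matrix

/-- The ADI splitting operator `M(α,β) = (α+β)⁻¹ (H + α I)(V + β I)`. -/
noncomputable def adiM {n : ℕ} (H V : Matrix (Fin n) (Fin n) ℂ) (α β : ℂ) :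
    Matrix (Fin n) (Fin n) ℂ :=
  (α + β)⁻¹ • ((H + α • 1) * (V + β • 1))

theorem add_smul_one_mul_add_smul_one {n : ℕ} (A : Matrix (Fin n) (Fin n) ℂ) (a b : ℂ) :
    (A + b • 1) * (A + a • 1) = A ^ 2 + (a + b) • A + (a * b) • 1 := by
  simp only [mul_add, add_mul, smul_mul_assoc, mul_smul_comm, one_mul, mul_one, pow_two,
    smul_add, smul_smul, add_smul]
  abel

theorem im_mul_apply_eq_zero {n : ℕ} {A B : Matrix (Fin n) (Fin n) ℂ}
    (hA : ∀ i j, (A i j).im = 0) (hB : ∀ i j, (B i j).im = 0) (i j : Fin n) :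
    ((A * B) i j).im = 0 := by
  simp [Matrix.mul_apply, Complex.im_sum, Complex.mul_im, hA, hB]

theorem im_quadratic_apply_eq_zero {n : ℕ} {A : Matrix (Fin n) (Fin n) ℂ} {s p : ℂ}
    (hA : ∀ i j, (A i j).im = 0) (hs : s.im = 0) (hp : p.im = 0) (i j : Fin n) :
    ((A ^ 2 + s • A + p • 1 : Matrix (Fin n) (Fin n) ℂ) i j).im = 0 := by
  have hone : ((1 : Matrix (Fin n) (Fin n) ℂ) i j).im = 0 := by
    rw [Matrix.one_apply]
    split_ifs <;> simp
  simp only [pow_two, Matrix.add_apply, Matrix.smul_apply, smul_eq_mul, Complex.add_im,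
    Complex.mul_im, im_mul_apply_eq_zero hA hA, hA, hs, hp, hone]
  simp

/-- Double-step `M`-operator: with `H V = V H`,
`(α'+β')(α+β) M(α',β') M(α,β) = (H² + (α+α')H + αα' I)(V² + (β+β')V + ββ' I)`;
moreover this matrix has real entries if `H`, `V` do and
`αα', α+α', ββ', β+β'` are real. -/
theorem adi_double_step_M {n : ℕ} (H V : Matrix (Fin n) (Fin n) ℂ)
    (hcomm : H * V = V * H)
    (α β α' β' : ℂ) (hαβ : α + β ≠ 0) (hαβ' : α' + β' ≠ 0) :
    ((α' + β') * (α + β)) • (adiM H V α' β' * adiM H V α β)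
      = (H ^ 2 + (α + α') • H + (α * α') • 1)
          * (V ^ 2 + (β + β') • V + (β * β') • 1) ∧
    ((∀ i j, (H i j).im = 0) → (∀ i j, (V i j).im = 0) →
      (α * α').im = 0 → (α + α').im = 0 → (β * β').im = 0 → (β + β').im = 0 →
      ∀ i j,
        ((((H ^ 2 + (α + α') • H + (α * α') • 1)
            * (V ^ 2 + (β + β') • V + (β * β') • 1) :
              Matrix (Fin n) (Fin n) ℂ)) i j).im = 0) := by
  constructor
  · have hswap : (V + β' • (1 : Matrix (Fin n) (Fin n) ℂ)) * (H + α • 1)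
        = (H + α • 1) * (V + β' • 1) := by
      simp only [mul_add, add_mul, smul_mul_assoc, mul_smul_comm, one_mul, mul_one, hcomm,
        smul_add, smul_comm α β']
      abel
    have hscal : (α' + β') * (α + β) * ((α' + β')⁻¹ * (α + β)⁻¹) = 1 := by
      field_simp
    have hprod : adiM H V α' β' * adiM H V α β
        = ((α' + β')⁻¹ * (α + β)⁻¹) •
          (((H + α' • 1) * (H + α • 1)) * ((V + β' • 1) * (V + β • 1))) := by
      simp only [adiM, smul_mul_smul_comm]
      rw [mul_assoc (H + α' • 1), ← mul_assoc (V + β' • 1), hswap]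
      simp only [mul_assoc]
    rw [hprod, smul_smul, hscal, one_smul, add_smul_one_mul_add_smul_one,
      add_smul_one_mul_add_smul_one]
  · intro hH hV h₁ h₂ h₃ h₄
    exact im_mul_apply_eq_zero (im_quadratic_apply_eq_zero hH h₂ h₁)
      (im_quadratic_apply_eq_zero hV h₄ h₃)
end

section
/- (Combined increment of two steps) Let X be a vector space over a field K and let M, M', N : X → X be linear maps with M and M' bijective and M ∘ M' = M' ∘ M. For r ∈ X define v := −M⁻¹ r, r' := (M⁻¹ ∘ N) r, and v' := −M'⁻¹ r'. Then (M' ∘ M)(v + v') = −(M' + N) r; i.e., the combined increment of two consecutive splitting steps is obtained by solving a single linear system with operator M' M and right-hand side −(M' + N) r. -/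
/-- Combined increment of two consecutive splitting steps: with `M`, `M'` bijective
(modeled as linear equivalences) and `M ∘ M' = M' ∘ M`, if `v = -M⁻¹ r`,
`r' = (M⁻¹ ∘ N) r` and `v' = -M'⁻¹ r'`, then `(M' ∘ M)(v + v') = -(M' + N) r`. -/
theorem combined_increment {K X : Type*} [Field K] [AddCommGroup X] [Module K X]
    (M M' : X ≃ₗ[K] X) (N : X →ₗ[K] X)
    (hcomm : M.toLinearMap ∘ₗ M'.toLinearMap = M'.toLinearMap ∘ₗ M.toLinearMap)
    (r v r' v' : X)
    (hv : v = -M.symm r)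
    (hr' : r' = M.symm (N r))
    (hv' : v' = -M'.symm r') :
    M' (M (v + v')) = -((M'.toLinearMap + N) r) := by
  have h : M' (M v') = M (M' v') := (LinearMap.congr_fun hcomm v').symm
  rw [map_add, map_add, h, hv, hv', hr']
  simp [add_comm]
end

section
/- (Real-valued Double-Step) Let H and V be n×n complex matrices with real entries satisfying H V = V H, and set A := H + V. Let α, β, α', β' ∈ ℂ with α + β ≠ 0, α' + β' ≠ 0, and α α', α + α', β β', β + β' ∈ ℝ. Let M := M(α,β), N := N(α,β), M' := M(α',β'), N' := N(α',β'), and assume M and M' are invertible. Let x, b ∈ ℂⁿ have real entries and set r := A x − b. Define r' := M⁻¹ N r, r'' := M'⁻¹ N' r', and x'' := x − M⁻¹ r − M'⁻¹ r'. Then x'' and r'' have real entries; i.e., after two ADI steps with such parameters (for example α' = conj(α) and β, β' ∈ ℝ) both iterate and residual are real again. -/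
open Matrix

/-- The ADI splitting operator `N(α,β) = (α+β)⁻¹ (H − β I)(V − α I)`. -/
noncomputable def adiN {n : ℕ} (H V : Matrix (Fin n) (Fin n) ℂ) (α β : ℂ) :
    Matrix (Fin n) (Fin n) ℂ :=
  (α + β)⁻¹ • ((H - β • 1) * (V - α • 1))

/-- If a real invertible matrix maps a vector to a real vector, then that vector is real. -/
theorem im_eq_zero_of_mulVec {n : ℕ} {P : Matrix (Fin n) (Fin n) ℂ} (hP : IsUnit P)
    (hPreal : (starRingEnd ℂ).mapMatrix P = P) {y z : Fin n → ℂ} (hPy : P *ᵥ y = z)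
    (hz : starRingEnd ℂ ∘ z = z) (i : Fin n) : (y i).im = 0 := by
  have key : P *ᵥ (starRingEnd ℂ ∘ y) = P *ᵥ y := by
    rw [hPy, ← hz, ← hPy]
    funext j
    have := RingHom.map_mulVec (starRingEnd ℂ) P y j
    rw [← RingHom.mapMatrix_apply, hPreal] at this
    exact this.symm
  exact Complex.conj_eq_iff_im.mp (congrFun (Matrix.mulVec_injective_of_isUnit hP key) i)

theorem mapMatrix_conj_smul {n : ℕ} (c : ℂ) (A : Matrix (Fin n) (Fin n) ℂ) :
    (starRingEnd ℂ).mapMatrix (c • A) = (starRingEnd ℂ c) • (starRingEnd ℂ).mapMatrix A := by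
  ext i j
  simp

theorem conj_comp_mulVec {n : ℕ} {A : Matrix (Fin n) (Fin n) ℂ} {v : Fin n → ℂ}
    (hA : (starRingEnd ℂ).mapMatrix A = A) (hv : starRingEnd ℂ ∘ v = v) :
    starRingEnd ℂ ∘ (A *ᵥ v) = A *ᵥ v := by
  funext j
  have := RingHom.map_mulVec (starRingEnd ℂ) A v j
  rwa [← RingHom.mapMatrix_apply, hA, hv] at this

/-- For commuting `H` and `V`, a product of four shifted factors regroups into two quadratics
whose coefficients are symmetric in the shifts. -/
theorem shifted_mul_shifted {n : ℕ} {H V : Matrix (Fin n) (Fin n) ℂ} (hcomm : H * V = V * H)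
    (a b a' b' : ℂ) :
    ((H + a' • 1) * (V + b' • 1)) * ((H + a • 1) * (V + b • 1)) =
      (H * H + (a + a') • H + (a * a') • 1) * (V * V + (b + b') • V + (b * b') • 1) := by
  have hc : ∀ X, V * (H * X) = H * (V * X) := fun X => by
    rw [← mul_assoc, ← hcomm, mul_assoc]
  simp only [mul_add, add_mul, smul_mul_assoc, mul_smul_comm, mul_one, one_mul, mul_assoc,
    hc, ← hcomm]
  module

theorem mapMatrix_conj_quadratic {n : ℕ} {A : Matrix (Fin n) (Fin n) ℂ}
    (hA : (starRingEnd ℂ).mapMatrix A = A) {s p : ℂ} (hs : starRingEnd ℂ s = s)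
    (hp : starRingEnd ℂ p = p) :
    (starRingEnd ℂ).mapMatrix (A * A + s • A + p • 1) = A * A + s • A + p • 1 := by
  rw [map_add, map_add, map_mul, mapMatrix_conj_smul, mapMatrix_conj_smul, hA, hs, hp, map_one]

/-- Real-valued double-step of the ADI: if `H`, `V`, `x`, `b` are real,
`H V = V H`, and the two shift pairs satisfy `αα', α+α', ββ', β+β' ∈ ℝ`,
then after two ADI steps both iterate `x''` and residual `r''` are real again. -/
theorem adi_real_double_step {n : ℕ} (H V : Matrix (Fin n) (Fin n) ℂ)
    (hH : ∀ i j, (H i j).im = 0) (hV : ∀ i j, (V i j).im = 0)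
    (hcomm : H * V = V * H)
    (α β α' β' : ℂ) (hαβ : α + β ≠ 0) (hαβ' : α' + β' ≠ 0)
    (h1 : (α * α').im = 0) (h2 : (α + α').im = 0)
    (h3 : (β * β').im = 0) (h4 : (β + β').im = 0)
    (hM : IsUnit (adiM H V α β)) (hM' : IsUnit (adiM H V α' β'))
    (x b : Fin n → ℂ)
    (hx : ∀ i, (x i).im = 0) (hb : ∀ i, (b i).im = 0)
    (r r' r'' x'' : Fin n → ℂ)
    (hr : r = (H + V).mulVec x - b)
    (hr' : r' = (adiM H V α β)⁻¹.mulVec ((adiN H V α β).mulVec r))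
    (hr'' : r'' = (adiM H V α' β')⁻¹.mulVec ((adiN H V α' β').mulVec r'))
    (hx'' : x'' = x - (adiM H V α β)⁻¹.mulVec r - (adiM H V α' β')⁻¹.mulVec r') :
    (∀ i, (x'' i).im = 0) ∧ (∀ i, (r'' i).im = 0) := by
  have conj_mat : ∀ A : Matrix (Fin n) (Fin n) ℂ, (∀ i j, (A i j).im = 0) →
      (starRingEnd ℂ).mapMatrix A = A := fun A hA => by
    ext i j
    exact Complex.conj_eq_iff_im.mpr (hA i j)
  have cH := conj_mat H hH
  have cV := conj_mat V hV
  have ca := Complex.conj_eq_iff_im.mpr h1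
  have ca' := Complex.conj_eq_iff_im.mpr h2
  have cb := Complex.conj_eq_iff_im.mpr h3
  have cb' := Complex.conj_eq_iff_im.mpr h4
  have cx : starRingEnd ℂ ∘ x = x := funext fun i => Complex.conj_eq_iff_im.mpr (hx i)
  have cr : starRingEnd ℂ ∘ r = r := by
    have hAx := conj_comp_mulVec (A := H + V) (by rw [map_add, cH, cV]) cx
    funext i
    rw [hr, Function.comp_apply, Pi.sub_apply, map_sub, Complex.conj_eq_iff_im.mpr (hb i)]
    exact congrArg (· - b i) (congrFun hAx i)
  have hMdet := (Matrix.isUnit_iff_isUnit_det _).mp hM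
  have hMdet' := (Matrix.isUnit_iff_isUnit_det _).mp hM'
  have hc : (α' + β') * (α + β) ≠ 0 := mul_ne_zero hαβ' hαβ
  have hsmul : ∀ X Y : Matrix (Fin n) (Fin n) ℂ,
      ((α' + β') * (α + β)) • (((α' + β')⁻¹ • X) * ((α + β)⁻¹ • Y)) = X * Y := fun X Y => by
    rw [smul_mul_smul_comm, smul_smul, ← mul_inv, mul_inv_cancel₀ hc, one_smul]
  obtain ⟨P, hPdef⟩ : ∃ P, P = ((α' + β') * (α + β)) • (adiM H V α' β' * adiM H V α β) :=
    ⟨_, rfl⟩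
  have hPunit : IsUnit P := by
    rw [hPdef, Matrix.isUnit_iff_isUnit_det, Matrix.det_smul, Matrix.det_mul]
    exact ((isUnit_iff_ne_zero.mpr hc).pow _).mul (hMdet'.mul hMdet)
  have hPreal : (starRingEnd ℂ).mapMatrix P = P := by
    rw [hPdef, adiM, adiM, hsmul, shifted_mul_shifted hcomm, map_mul,
      mapMatrix_conj_quadratic cH ca' ca, mapMatrix_conj_quadratic cV cb' cb]
  have hNcomm : adiM H V α β * adiN H V α' β' = adiN H V α' β' * adiM H V α β := by
    simp only [adiM, adiN, smul_mul_smul_comm, sub_eq_add_neg, ← neg_smul,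
      shifted_mul_shifted hcomm]
    congr 1
    · ring
    · simp only [add_comm, mul_comm]
  have hMr' : adiM H V α β *ᵥ r' = adiN H V α β *ᵥ r := by
    rw [hr', Matrix.mulVec_mulVec, Matrix.mul_nonsing_inv _ hMdet, Matrix.one_mulVec]
  have hMr'' : adiM H V α' β' *ᵥ r'' = adiN H V α' β' *ᵥ r' := by
    rw [hr'', Matrix.mulVec_mulVec, Matrix.mul_nonsing_inv _ hMdet', Matrix.one_mulVec]
  have hMcomm : adiM H V α' β' * adiM H V α β = adiM H V α β * adiM H V α' β' := by
    simp only [adiM, smul_mul_smul_comm, shifted_mul_shifted hcomm, add_comm, mul_comm]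
  constructor
  · have hy : P *ᵥ (x - x'') =
        ((α + β + (α' + β')) • (H * V) + (β * β' - α * α') • H + (α * α' - β * β') • V
          + (α * α' * (β + β') + β * β' * (α + α')) • 1) *ᵥ r := by
      have hd : x - x'' = (adiM H V α β)⁻¹ *ᵥ r + (adiM H V α' β')⁻¹ *ᵥ r' := by
        rw [hx'']; abel
      have e1 : (adiM H V α' β' * adiM H V α β) *ᵥ ((adiM H V α β)⁻¹ *ᵥ r)
          = adiM H V α' β' *ᵥ r := by
        rw [Matrix.mulVec_mulVec, Matrix.mul_assoc, Matrix.mul_nonsing_inv _ hMdet, mul_one]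
      have e2 : (adiM H V α' β' * adiM H V α β) *ᵥ ((adiM H V α' β')⁻¹ *ᵥ r')
          = adiN H V α β *ᵥ r := by
        rw [hMcomm, Matrix.mulVec_mulVec, Matrix.mul_assoc, Matrix.mul_nonsing_inv _ hMdet',
          mul_one, hMr']
      rw [hd, hPdef, Matrix.smul_mulVec, Matrix.mulVec_add, e1, e2, ← Matrix.add_mulVec,
        ← Matrix.smul_mulVec]
      congr 1
      have s1 : (α' + β') * (α + β) * (α' + β')⁻¹ = α + β := by field_simp
      have s2 : (α' + β') * (α + β) * (α + β)⁻¹ = α' + β' := by field_simp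
      rw [smul_add, adiM, adiN, smul_smul, smul_smul, s1, s2]
      simp only [mul_add, add_mul, mul_sub, sub_mul, smul_mul_assoc, mul_smul_comm, mul_one,
        one_mul]
      module
    have hd := im_eq_zero_of_mulVec hPunit hPreal hy (conj_comp_mulVec (by
      have hs : starRingEnd ℂ (α + β + (α' + β')) = α + β + (α' + β') := by
        rw [add_add_add_comm, map_add, ca', cb']
      have hd : starRingEnd ℂ (β * β' - α * α') = β * β' - α * α' := by rw [map_sub, ca, cb]
      have hd' : starRingEnd ℂ (α * α' - β * β') = α * α' - β * β' := by rw [map_sub, ca, cb]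
      have hk : starRingEnd ℂ (α * α' * (β + β') + β * β' * (α + α')) =
          α * α' * (β + β') + β * β' * (α + α') := by
        rw [map_add, map_mul, map_mul (starRingEnd ℂ) (β * β'), ca, cb, ca', cb']
      rw [map_add, map_add, map_add]
      simp only [mapMatrix_conj_smul, hs, hd, hd', hk]
      rw [map_mul, cH, cV, map_one]) cr)
    intro i
    have := hd i
    rw [Pi.sub_apply, Complex.sub_im, hx i] at this
    linarith
  · have hr2 : P *ᵥ r'' =
        (((α' + β') * (α + β)) • (adiN H V α' β' * adiN H V α β)) *ᵥ r := by
      rw [hPdef, hMcomm, Matrix.smul_mulVec, Matrix.smul_mulVec, ← Matrix.mulVec_mulVec, hMr'',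
        Matrix.mulVec_mulVec, hNcomm, ← Matrix.mulVec_mulVec, hMr', Matrix.mulVec_mulVec]
    refine im_eq_zero_of_mulVec hPunit hPreal hr2 (conj_comp_mulVec ?_ cr)
    have hneg : ∀ {s : ℂ}, starRingEnd ℂ s = s → starRingEnd ℂ (-s) = -s := fun h => by
      rw [map_neg, h]
    rw [adiN, adiN, hsmul]
    simp only [sub_eq_add_neg, ← neg_smul]
    rw [shifted_mul_shifted hcomm, map_mul, neg_mul_neg, neg_mul_neg, ← neg_add, ← neg_add,
      mapMatrix_conj_quadratic cH (hneg cb') cb, mapMatrix_conj_quadratic cV (hneg ca') ca]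
end

section
/- (Exact termination with spectral shifts) Let A be an n×n complex matrix and let α : Fin n → ℂ be such that the characteristic polynomial of A factors as charpoly(A) = ∏_{i} (X − conj(α i)) and A + (α i) I is invertible for every i. Then the product of the corresponding Cayley transformations vanishes: ∏_{i=0}^{n−1} (A + (α i) I)⁻¹ (A − conj(α i) I) = 0 (the factors pairwise commute, so the order of the product is irrelevant). -/
open Matrix Polynomial

/-- A product of products splits when every second factor commutes with every first factor. -/
theorem List.prod_map_mul_of_commute {ι M : Type*} [Monoid M] (f g : ι → M)
    (h : ∀ i j, Commute (g i) (f j)) (l : List ι) :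
    (l.map fun i => f i * g i).prod = (l.map f).prod * (l.map g).prod := by
  induction l with
  | nil => simp
  | cons a l ih =>
    have hc : Commute (g a) (l.map f).prod := by
      refine Commute.list_prod_right _ _ fun x hx => ?_
      obtain ⟨j, -, rfl⟩ := List.mem_map.1 hx
      exact h a j
    simp only [List.map_cons, List.prod_cons, ih]
    rw [mul_assoc, ← mul_assoc (g a), hc.eq, mul_assoc, mul_assoc]

/-- Exact termination with spectral shifts: if the characteristic polynomial of `A`
factors as `∏ i (X − conj(α i))` and each `A + (α i) I` is invertible, then the
(ordered) product of the Cayley transformations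
`(A + (α i) I)⁻¹ (A − conj(α i) I)` over `i = 0, …, n−1` vanishes. -/
theorem cayley_product_vanishes {n : ℕ}
    (A : Matrix (Fin n) (Fin n) ℂ) (α : Fin n → ℂ)
    (hchar : A.charpoly = ∏ i, (X - C ((starRingEnd ℂ) (α i))))
    (hinv : ∀ i, IsUnit (A + α i • 1)) :
    (List.ofFn fun i : Fin n =>
        (A + α i • 1)⁻¹ * (A - (starRingEnd ℂ) (α i) • 1)).prod = 0 := by
  have hcomm (i j : Fin n) :
      Commute (A - (starRingEnd ℂ) (α i) • 1) (A + α j • 1)⁻¹ := by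
    rw [← Matrix.zpow_neg_one]
    refine Matrix.Commute.zpow_right ?_ _
    have hA : Commute A (A + α j • 1) :=
      (Commute.refl A).add_right ((Commute.one_right A).smul_right _)
    exact hA.sub_left ((Commute.one_left _).smul_left _)
  have hzero : ((List.finRange n).map fun i => A - (starRingEnd ℂ) (α i) • 1).prod = 0 := by
    rw [← A.aeval_self_charpoly, hchar, ← List.prod_ofFn, map_list_prod, List.map_ofFn,
      List.ofFn_eq_map]
    simp [Function.comp_def, Algebra.algebraMap_eq_smul_one]
  rw [List.ofFn_eq_map, List.prod_map_mul_of_commute _ _ hcomm, hzero, mul_zero]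
end
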